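/- Let 2 ≤ n ≤ m with m ≥ (n − 2)(n − 1). Then the scramble number of the rook graph K_n □ K_m equals (n − 1)·m; moreover this is the order of the scramble S*_{n,m} whose eggs are all connected vertex subsets of size n − 1. -/

import Mathlib

/-- Decidability of adjacency in a box product of simple graphs. -/
instance {α β : Type*} (G : SimpleGraph α) (H : SimpleGraph β) [DecidableEq α] [DecidableEq β]
    [DecidableRel G.Adj] [DecidableRel H.Adj] : DecidableRel (G □ H).Adj := fun _ _ =>
  decidable_of_iff _ SimpleGraph.boxProd_adj.symm

/-- The two-dimensional rook graph `K_n □ K_m`: the box product of the complete graphs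
on `n` and `m` vertices. -/
def rook (n m : ℕ) : SimpleGraph (Fin n × Fin m) :=
  (⊤ : SimpleGraph (Fin n)) □ (⊤ : SimpleGraph (Fin m))

instance (n m : ℕ) : DecidableRel (rook n m).Adj := by unfold rook; infer_instance

/-- A scramble on `G`: a collection of nonempty vertex subsets (eggs), each of which
induces a connected subgraph. -/
def IsScramble {V : Type*} (G : SimpleGraph V) (S : Set (Finset V)) : Prop :=
  ∀ E ∈ S, E.Nonempty ∧ (G.induce (E : Set V)).Connected

/-- A hitting set of a scramble: a vertex set intersecting every egg. -/
def IsHittingSet {V : Type*} [DecidableEq V] (S : Set (Finset V)) (H : Finset V) : Prop :=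
  ∀ E ∈ S, (E ∩ H).Nonempty

/-- The number of edges with one endpoint in `X` and the other outside `X`. -/
def cutSize {V : Type*} [Fintype V] [DecidableEq V] (G : SimpleGraph V) [DecidableRel G.Adj]
    (X : Finset V) : ℕ :=
  (Finset.univ.filter (fun p : V × V => G.Adj p.1 p.2 ∧ p.1 ∈ X ∧ p.2 ∉ X)).card

/-- The partition `(X, Xᶜ)` is an egg cut of `S` if some egg is contained in `X` and
some egg is contained in `Xᶜ`. -/
def IsEggCut {V : Type*} [Fintype V] [DecidableEq V] (S : Set (Finset V)) (X : Finset V) : Prop :=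
  (∃ E ∈ S, E ⊆ X) ∧ (∃ E ∈ S, E ⊆ Xᶜ)

/-- The order of a scramble: the minimum of the minimal hitting set size and the minimal
egg cut-set size (`⊤` if no hitting set/egg cut exists). -/
noncomputable def scrambleOrder {V : Type*} [Fintype V] [DecidableEq V] (G : SimpleGraph V)
    [DecidableRel G.Adj] (S : Set (Finset V)) : ℕ∞ :=
  min (sInf {k : ℕ∞ | ∃ H : Finset V, IsHittingSet S H ∧ (H.card : ℕ∞) = k})
      (sInf {k : ℕ∞ | ∃ X : Finset V, IsEggCut S X ∧ (cutSize G X : ℕ∞) = k})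

/-- The scramble number of a graph: the maximum order of a scramble on it. -/
noncomputable def scrambleNumber {V : Type*} [Fintype V] [DecidableEq V] (G : SimpleGraph V)
    [DecidableRel G.Adj] : ℕ∞ :=
  sSup {k : ℕ∞ | ∃ S : Set (Finset V), IsScramble G S ∧ scrambleOrder G S = k}

/-- The scramble `S*_{n,m}` on `K_n □ K_m` whose eggs are exactly the vertex subsets of
size `n - 1` inducing connected subgraphs. -/
def SStar (n m : ℕ) : Set (Finset (Fin n × Fin m)) :=
  {E | E.card = n - 1 ∧ ((rook n m).induce (E : Set (Fin n × Fin m))).Connected}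

open Finset in
/-- The edge boundary of `X` in the rook graph, counted row by row and column by column. -/
lemma cutSize_rook {n m : ℕ} (X : Finset (Fin n × Fin m)) :
    cutSize (rook n m) X =
      ∑ i, #{j | (i, j) ∈ X} * #{j | (i, j) ∉ X} + ∑ j, #{i | (i, j) ∈ X} * #{i | (i, j) ∉ X} := by
  have key : ∀ p : (Fin n × Fin m) × (Fin n × Fin m),
      (if (rook n m).Adj p.1 p.2 ∧ p.1 ∈ X ∧ p.2 ∉ X then 1 else 0) =
      (if p.1.1 = p.2.1 then
        (if p.1 ∈ X then 1 else 0) * (if (p.1.1, p.2.2) ∉ X then 1 else 0) else 0) +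
      (if p.1.2 = p.2.2 then
        (if p.1 ∈ X then 1 else 0) * (if (p.2.1, p.1.2) ∉ X then 1 else 0) else 0) := by
    rintro ⟨⟨i, j⟩, ⟨i', j'⟩⟩
    simp only [rook, SimpleGraph.boxProd_adj, SimpleGraph.top_adj]
    by_cases h1 : i = i' <;> by_cases h2 : j = j' <;> by_cases h3 : (i, j) ∈ X <;>
      simp_all
  rw [cutSize, card_filter, sum_congr rfl fun p _ => key p, sum_add_distrib]
  congr 1
  · simp only [Fintype.sum_prod_type]
    refine sum_congr rfl fun i _ => ?_
    rw [card_filter, card_filter, sum_mul_sum]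
    refine sum_congr rfl fun j _ => ?_
    rw [sum_comm]
    simp
  · simp only [Fintype.sum_prod_type]
    rw [sum_comm]
    refine sum_congr rfl fun j _ => ?_
    rw [card_filter, card_filter, sum_mul_sum]
    refine sum_congr rfl fun i _ => ?_
    simp

lemma cutSize_compl {V : Type*} [Fintype V] [DecidableEq V] (G : SimpleGraph V)
    [DecidableRel G.Adj] (X : Finset V) : cutSize G Xᶜ = cutSize G X := by
  refine Finset.card_equiv (Equiv.prodComm V V) fun p => ?_
  simp [G.adj_comm p.1 p.2, and_comm]

open Finset in
lemma card_row_add_card_compl {n m : ℕ} (X : Finset (Fin n × Fin m)) (i : Fin n) :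
    #{j | (i, j) ∈ X} + #{j | (i, j) ∉ X} = m := by
  rw [card_filter_add_card_filter_not, card_univ, Fintype.card_fin]

open Finset in
lemma card_col_add_card_compl {n m : ℕ} (X : Finset (Fin n × Fin m)) (j : Fin m) :
    #{i | (i, j) ∈ X} + #{i | (i, j) ∉ X} = n := by
  rw [card_filter_add_card_filter_not, card_univ, Fintype.card_fin]

lemma pred_le_mul_of_add_eq {a b c : ℕ} (ha : 1 ≤ a) (hb : 1 ≤ b) (h : a + b = c) :
    c - 1 ≤ a * b := by
  obtain ⟨a, rfl⟩ := Nat.exists_eq_add_of_le' ha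
  obtain ⟨b, rfl⟩ := Nat.exists_eq_add_of_le' hb
  have : (a + 1) * (b + 1) = a * b + a + b + 1 := by ring
  omega

open Finset in
lemma sum_card_row {n m : ℕ} (X : Finset (Fin n × Fin m)) :
    ∑ i, #{j | (i, j) ∈ X} = #X := by
  simp only [card_filter]
  rw [← Fintype.sum_prod_type (f := fun p => if p ∈ X then 1 else 0), ← card_filter]
  simp

open Finset in
/-- A large enough vertex set missing some row has at least `(n - 1) * m` boundary edges. -/
lemma le_cutSize_rook_of_row_empty {n m : ℕ} {X : Finset (Fin n × Fin m)} (hX : n - 1 ≤ #X)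
    (i₀ : Fin n) (hi₀ : ∀ j, (i₀, j) ∉ X) : (n - 1) * m ≤ cutSize (rook n m) X := by
  rw [cutSize_rook]
  set B : Finset (Fin m) := {j | ∃ i, (i, j) ∈ X} with hB
  have hrow : (n - 1) * (m - #B) ≤ ∑ i, #{j | (i, j) ∈ X} * #{j | (i, j) ∉ X} :=
    calc (n - 1) * (m - #B) ≤ #X * (m - #B) := Nat.mul_le_mul_right _ hX
      _ = ∑ i, #{j | (i, j) ∈ X} * (m - #B) := by rw [← sum_mul, sum_card_row]
      _ ≤ _ := sum_le_sum fun i _ => Nat.mul_le_mul_left _ <| by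
        have h1 := card_row_add_card_compl X i
        have h2 : #{j | (i, j) ∈ X} ≤ #B := card_le_card fun j hj => by
          simp only [hB, mem_filter, mem_univ, true_and] at hj ⊢
          exact ⟨i, hj⟩
        omega
  have hcol : (n - 1) * #B ≤ ∑ j, #{i | (i, j) ∈ X} * #{i | (i, j) ∉ X} :=
    calc (n - 1) * #B = ∑ j ∈ B, (n - 1) := by rw [sum_const, smul_eq_mul, mul_comm]
      _ ≤ ∑ j ∈ B, #{i | (i, j) ∈ X} * #{i | (i, j) ∉ X} := sum_le_sum fun j hj => by
        obtain ⟨i, hi⟩ := (mem_filter.1 hj).2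
        exact pred_le_mul_of_add_eq (card_pos.2 ⟨i, by simpa using hi⟩)
          (card_pos.2 ⟨i₀, by simpa using hi₀ j⟩) (card_col_add_card_compl X j)
      _ ≤ _ := sum_le_sum_of_subset (subset_univ B)
  have hBm : #B ≤ m := by simpa using card_le_univ B
  calc (n - 1) * m = (n - 1) * (m - #B) + (n - 1) * #B := by
        rw [← mul_add, Nat.sub_add_cancel hBm]
    _ ≤ _ := add_le_add hrow hcol

open Finset in
/-- Edge isoperimetry: a vertex set which, together with its complement, is large enough
has at least `(n - 1) * m` boundary edges. -/
lemma le_cutSize_rook {n m : ℕ} (hnm : n ≤ m) {X : Finset (Fin n × Fin m)}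
    (hX : n - 1 ≤ #X) (hXc : n - 1 ≤ #Xᶜ) : (n - 1) * m ≤ cutSize (rook n m) X := by
  by_cases h1 : ∃ i₀, ∀ j, (i₀, j) ∉ X
  · obtain ⟨i₀, h⟩ := h1
    exact le_cutSize_rook_of_row_empty hX i₀ h
  by_cases h2 : ∃ i₀, ∀ j, (i₀, j) ∈ X
  · obtain ⟨i₀, h⟩ := h2
    rw [← cutSize_compl]
    exact le_cutSize_rook_of_row_empty hXc i₀ fun j => by simpa using h j
  push Not at h1 h2
  rw [cutSize_rook]
  calc (n - 1) * m ≤ n * (m - 1) := by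
        rw [Nat.sub_mul, Nat.mul_sub, one_mul, mul_one]
        exact Nat.sub_le_sub_left hnm _
    _ = ∑ i : Fin n, (m - 1) := by simp
    _ ≤ ∑ i, #{j | (i, j) ∈ X} * #{j | (i, j) ∉ X} := sum_le_sum fun i _ => by
        obtain ⟨j, hj⟩ := h1 i
        obtain ⟨j', hj'⟩ := h2 i
        exact pred_le_mul_of_add_eq (card_pos.2 ⟨j, by simpa using hj⟩)
          (card_pos.2 ⟨j', by simpa using hj'⟩) (card_row_add_card_compl X i)
    _ ≤ _ := Nat.le_add_right _ _

/-- Inside a connected vertex set there are connected vertex sets of every smaller size. -/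
lemma exists_connected_induce_subset_card {V : Type*} [DecidableEq V] (G : SimpleGraph V) {k : ℕ}
    (hk : 1 ≤ k) (s : Finset V) (hs : (G.induce (s : Set V)).Connected) (hks : k ≤ s.card) :
    ∃ t ⊆ s, t.card = k ∧ (G.induce (t : Set V)).Connected := by
  induction s using Finset.strongInduction with
  | H s ih =>
    obtain h | h := hks.eq_or_lt
    · exact ⟨s, subset_rfl, h.symm, hs⟩
    have : Nontrivial (s : Set V) :=
      Set.nontrivial_coe_sort.2 (Finset.one_lt_card_iff_nontrivial.1 (by omega))
    obtain ⟨v, hv⟩ := hs.exists_connected_induce_compl_singleton_of_finite_nontrivial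
    have hvs : (v : V) ∈ s := v.2
    have hconn : (G.induce ((s.erase v : Finset V) : Set V)).Connected := by
      refine hv.map (G := (G.induce (s : Set V)).induce {v}ᶜ)
        ⟨fun x => ⟨x.1.1, ?_⟩, fun h => h⟩ ?_
      · rw [Finset.mem_coe, Finset.mem_erase]
        exact ⟨fun h => x.2 (Subtype.ext h), x.1.2⟩
      · rintro ⟨x, hx⟩
        rw [Finset.mem_coe, Finset.mem_erase] at hx
        exact ⟨⟨⟨x, hx.2⟩, fun h => hx.1 (congrArg Subtype.val h)⟩, rfl⟩
    obtain ⟨t, ht, h'⟩ := ih _ (Finset.erase_ssubset hvs) hconn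
      (by rw [Finset.card_erase_of_mem hvs]; omega)
    exact ⟨t, ht.trans (Finset.erase_subset _ _), h'⟩

/-- A vertex set of the rook graph without connected subsets of size `n - 1` has at most
`m` elements. -/
lemma card_le_of_forall_not_connected {n m : ℕ} (hn : 2 ≤ n) (hm : (n - 2) * (n - 1) ≤ m)
    (C : Finset (Fin n × Fin m))
    (hC : ∀ t ⊆ C, t.card = n - 1 → ¬ ((rook n m).induce (t : Set (Fin n × Fin m))).Connected) :
    C.card ≤ m := by
  classical
  by_cases hcol : Set.InjOn Prod.snd (C : Set (Fin n × Fin m))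
  · simpa using Finset.card_le_card_of_injOn (t := Finset.univ) Prod.snd (by simp) hcol
  obtain ⟨⟨i, j⟩, hv, ⟨i', j'⟩, hv', rfl, hne⟩ :
      ∃ v ∈ C, ∃ v' ∈ C, v.2 = v'.2 ∧ v ≠ v' := by
    simpa [Set.InjOn, and_assoc] using hcol
  have hii' : i ≠ i' := fun h => hne (by simp [h])
  let G := (rook n m).induce (C : Set (Fin n × Fin m))
  have hsame : ∀ x y : (C : Set (Fin n × Fin m)), x.1.1 = y.1.1 →
      G.connectedComponentMk x = G.connectedComponentMk y := by
    intro x y hxy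
    by_cases h : x = y
    · rw [h]
    refine SimpleGraph.ConnectedComponent.sound (SimpleGraph.Adj.reachable ?_)
    refine SimpleGraph.boxProd_adj.2 (Or.inr ⟨fun h2 => h (Subtype.ext (Prod.ext hxy h2)), hxy⟩)
  have hvv' : G.connectedComponentMk ⟨(i, j), hv⟩ = G.connectedComponentMk ⟨(i', j), hv'⟩ :=
    SimpleGraph.ConnectedComponent.sound <| SimpleGraph.Adj.reachable <|
      SimpleGraph.boxProd_adj.2 (Or.inl ⟨hii', rfl⟩)
  have hrep : ∀ c : G.ConnectedComponent, ∃ x : (C : Set (Fin n × Fin m)),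
      G.connectedComponentMk x = c ∧ x.1.1 ≠ i' := by
    intro c
    induction c using SimpleGraph.ConnectedComponent.ind with
    | h x =>
      by_cases hx : x.1.1 = i'
      · exact ⟨⟨(i, j), hv⟩, hvv'.trans (hsame ⟨(i', j), hv'⟩ x hx.symm), hii'⟩
      · exact ⟨x, rfl, hx⟩
  choose rep hrep hrep' using hrep
  have hcomp : Fintype.card G.ConnectedComponent ≤ n - 1 := by
    have := Finset.card_le_card_of_injOn (s := Finset.univ) (t := Finset.univ.erase i')
      (fun c => (rep c).1.1) (by simp [hrep']) (fun c _ d _ h => by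
        rw [← hrep c, ← hrep d]; exact hsame _ _ h)
    simpa using this
  have hsize : ∀ c : G.ConnectedComponent,
      (Finset.univ.filter fun x => G.connectedComponentMk x = c).card ≤ n - 2 := by
    intro c
    by_contra! hlt
    set T := (Finset.univ.filter fun x => G.connectedComponentMk x = c).map
      (Function.Embedding.subtype _) with hT
    have hTC : T ⊆ C := fun x hx => by
      obtain ⟨y, -, rfl⟩ := Finset.mem_map.1 hx
      exact y.2
    have hconn : ((rook n m).induce (T : Set (Fin n × Fin m))).Connected := by
      refine c.connected_toSimpleGraph.map ⟨fun x => ⟨x.1.1, ?_⟩, fun h => h⟩ ?_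
      · exact Finset.mem_map.2 ⟨x.1, Finset.mem_filter.2 ⟨Finset.mem_univ _, x.2⟩, rfl⟩
      · rintro ⟨x, hx⟩
        obtain ⟨y, hy, rfl⟩ := Finset.mem_map.1 hx
        exact ⟨⟨y, (Finset.mem_filter.1 hy).2⟩, rfl⟩
    obtain ⟨t, ht, htc, htconn⟩ := exists_connected_induce_subset_card (rook n m)
      (k := n - 1) (by omega) T hconn (by rw [hT, Finset.card_map]; omega)
    exact hC t (ht.trans hTC) htc htconn
  have hcard := Finset.card_le_mul_card_image_of_maps_to (s := Finset.univ) (t := Finset.univ)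
    (f := G.connectedComponentMk) (fun _ _ => Finset.mem_univ _) (n - 2) (fun c _ => hsize c)
  calc C.card = (Finset.univ : Finset (C : Set (Fin n × Fin m))).card := by simp
    _ ≤ (n - 2) * Fintype.card G.ConnectedComponent := hcard
    _ ≤ (n - 2) * (n - 1) := Nat.mul_le_mul_left _ hcomp
    _ ≤ m := hm

open Finset in
lemma card_filter_fst_eq {n m : ℕ} (i : Fin n) :
    #{p : Fin n × Fin m | p.1 = i} = m := by
  rw [← sum_card_row, Finset.sum_eq_single i] <;> simp +contextual

open Finset in
lemma cutSize_rook_row {n m : ℕ} (i : Fin n) :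
    cutSize (rook n m) {p | p.1 = i} = (n - 1) * m := by
  rw [cutSize_rook, sum_eq_zero, zero_add]
  · simp [filter_ne', filter_eq', mul_comm]
  · intro k _
    by_cases h : k = i <;> simp [h]

/-- Every scramble on the rook graph has order at most `(n - 1) * m`. -/
lemma scrambleOrder_rook_le {n m : ℕ} (hn : 2 ≤ n) (S : Set (Finset (Fin n × Fin m))) :
    scrambleOrder (rook n m) S ≤ (((n - 1) * m : ℕ) : ℕ∞) := by
  by_cases h : ∀ i : Fin n, ∃ E ∈ S, E ⊆ Finset.univ.filter fun p => p.1 = i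
  · refine (min_le_right _ _).trans (sInf_le ?_)
    refine ⟨Finset.univ.filter fun p => p.1 = ⟨0, by omega⟩, ⟨h _, ?_⟩, ?_⟩
    · obtain ⟨E, hE, hE'⟩ := h ⟨1, by omega⟩
      refine ⟨E, hE, fun x hx => ?_⟩
      have := (Finset.mem_filter.1 (hE' hx)).2
      simp [this]
    · rw [cutSize_rook_row]
  · push Not at h
    obtain ⟨i, hi⟩ := h
    refine (min_le_left _ _).trans (sInf_le ?_)
    refine ⟨(Finset.univ.filter fun p => p.1 = i)ᶜ, fun E hE => ?_, ?_⟩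
    · obtain ⟨x, hx, hx'⟩ := Finset.not_subset.1 (hi E hE)
      exact ⟨x, Finset.mem_inter.2 ⟨hx, Finset.mem_compl.2 hx'⟩⟩
    · rw [Finset.card_compl, card_filter_fst_eq, Fintype.card_prod, Fintype.card_fin,
        Fintype.card_fin, Nat.sub_mul, one_mul]

lemma le_scrambleOrder_SStar {n m : ℕ} (hn : 2 ≤ n) (hnm : n ≤ m) (hm : (n - 2) * (n - 1) ≤ m) :
    (((n - 1) * m : ℕ) : ℕ∞) ≤ scrambleOrder (rook n m) (SStar n m) := by
  refine le_min (le_sInf ?_) (le_sInf ?_)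
  · rintro _ ⟨H, hH, rfl⟩
    have hcard := card_le_of_forall_not_connected hn hm Hᶜ fun t ht htc htconn => by
      obtain ⟨x, hx⟩ := hH t ⟨htc, htconn⟩
      rw [Finset.mem_inter] at hx
      exact Finset.mem_compl.1 (ht hx.1) hx.2
    rw [Finset.card_compl, Fintype.card_prod, Fintype.card_fin, Fintype.card_fin] at hcard
    rw [Nat.cast_le, Nat.sub_mul, one_mul]
    omega
  · rintro _ ⟨X, ⟨⟨E, hE, hEX⟩, E', hE', hEX'⟩, rfl⟩
    exact Nat.cast_le.2 (le_cutSize_rook hnm (hE.1 ▸ Finset.card_le_card hEX)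
      (hE'.1 ▸ Finset.card_le_card hEX'))

lemma isScramble_SStar {n m : ℕ} (hn : 2 ≤ n) : IsScramble (rook n m) (SStar n m) :=
  fun _ hE => ⟨Finset.card_pos.1 (by have := hE.1; omega), hE.2⟩

/-- For `2 ≤ n ≤ m` with `m ≥ (n - 2) * (n - 1)`, the scramble number of `K_n □ K_m`
equals `(n - 1) * m`, and this is the order of `S*_{n,m}`. -/
theorem sn_rook_large_m (n m : ℕ) (hn : 2 ≤ n) (hnm : n ≤ m) (hm : (n - 2) * (n - 1) ≤ m) :
    scrambleNumber (rook n m) = (((n - 1) * m : ℕ) : ℕ∞) ∧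
    scrambleOrder (rook n m) (SStar n m) = (((n - 1) * m : ℕ) : ℕ∞) := by
  have hS : scrambleOrder (rook n m) (SStar n m) = (((n - 1) * m : ℕ) : ℕ∞) :=
    le_antisymm (scrambleOrder_rook_le hn _) (le_scrambleOrder_SStar hn hnm hm)
  refine ⟨le_antisymm (sSup_le ?_) (le_sSup ⟨_, isScramble_SStar hn, hS⟩), hS⟩
  rintro _ ⟨S, -, rfl⟩
  exact scrambleOrder_rook_le hn S
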